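/- Let Δ ≥ 0 be a real number and let a, b : ℕ → ℝ satisfy |a i − b i| ≤ Δ for all i, and a (i + 1) ≥ a i + 6Δ for all i. Then for every real time t and every n, the number of indices i < n with a i ≤ t and the number of indices i < n with b i ≤ t differ by at most 1. In other words, the counters on the two contracts never differ by more than 1. -/

import Mathlib

/-- If each term of a sequence exceeds the previous one by at least `c ≥ 0`, then so does every
later term. -/
theorem add_le_of_lt_of_add_le_succ {a : ℕ → ℝ} {c : ℝ} (hc : 0 ≤ c)
    (h : ∀ i, a i + c ≤ a (i + 1)) {i j : ℕ} (hij : i < j) : a i + c ≤ a j := by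
  have hmono : Monotone a := monotone_nat_of_le_succ fun k => by linarith [h k]
  exact (h i).trans (hmono hij)

open Classical in
/-- If at most one index satisfies `p` but not `q`, then `p` holds at most once more than `q`. -/
theorem card_filter_le_card_filter_add_one {α : Type*} (s : Finset α) (p q : α → Prop)
    (h : ∀ i j, p i → ¬ q i → p j → ¬ q j → i = j) :
    (s.filter p).card ≤ (s.filter q).card + 1 := by
  have hone : (s.filter p \ s.filter q).card ≤ 1 := by
    refine Finset.card_le_one.2 fun i hi j hj => ?_
    simp only [Finset.mem_sdiff, Finset.mem_filter, not_and] at hi hj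
    exact h i j hi.1.2 (hi.2 hi.1.1) hj.1.2 (hj.2 hj.1.1)
  have := Finset.card_le_card_sdiff_add_card (s := s.filter p) (t := s.filter q)
  omega

open Classical in
/-- If the `i`-th counter increments on the two contracts occur at times `a i`
and `b i` with `|a i − b i| ≤ Δ`, and successive increments on contract `AB`
are at least `6Δ` apart, then at every time `t` the counter values on the two
contracts (the numbers of increments that have occurred among the first `n`)
differ by at most 1. -/
theorem counters_differ_by_at_most_one
    (Δ : ℝ) (hΔ : 0 ≤ Δ) (a b : ℕ → ℝ)
    (hstag : ∀ i, |a i - b i| ≤ Δ)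
    (hsep : ∀ i, a (i + 1) ≥ a i + 6 * Δ) :
    ∀ (t : ℝ) (n : ℕ),
      |(((Finset.range n).filter (fun i => a i ≤ t)).card : ℤ) -
        (((Finset.range n).filter (fun i => b i ≤ t)).card : ℤ)| ≤ 1 := by
  intro t n
  have hgap : ∀ {i j}, i < j → a i + 6 * Δ ≤ a j :=
    add_le_of_lt_of_add_le_succ (by linarith) hsep
  have hstag' : ∀ i, a i - b i ≤ Δ ∧ b i - a i ≤ Δ := fun i => by
    have := abs_le.1 (hstag i)
    constructor <;> linarith
  have hab := card_filter_le_card_filter_add_one (Finset.range n) (a · ≤ t) (b · ≤ t) <| by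
    intro i j hai hbi haj hbj
    rw [not_le] at hbi hbj
    rcases lt_trichotomy i j with hij | hij | hij
    · linarith [hgap hij, (hstag' i).2]
    · exact hij
    · linarith [hgap hij, (hstag' j).2]
  have hba := card_filter_le_card_filter_add_one (Finset.range n) (b · ≤ t) (a · ≤ t) <| by
    intro i j hbi hai hbj haj
    rw [not_le] at hai haj
    rcases lt_trichotomy i j with hij | hij | hij
    · linarith [hgap hij, (hstag' j).1]
    · exact hij
    · linarith [hgap hij, (hstag' i).1]
  rw [abs_le]
  constructor <;> omega
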